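/- arXiv:2210.11062 — 5 statements merged into one kernel-verified Lean document; each statement's English description precedes it below -/
import Mathlib

section
/- Let τ ∈ ℝ. For all u, v ∈ ℝ, ρ_τ(u − v) − ρ_τ(u) = −v·(τ − 1{u ≤ 0}) + ∫_0^v (1{u ≤ s} − 1{u ≤ 0}) ds (Knight's identity for the check function). -/
open MeasureTheory

/-- The check function `ρ_τ(u) = u (τ - 1{u ≤ 0})`. -/
noncomputable def checkFun (τ u : ℝ) : ℝ := u * (τ - if u ≤ 0 then 1 else 0)

theorem intervalIntegrable_ite_le (u a b : ℝ) :
    IntervalIntegrable (fun s : ℝ => if u ≤ s then (1 : ℝ) else 0) volume a b := by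
  refine Monotone.intervalIntegrable fun x y hxy => ?_
  split_ifs <;> linarith

/-- The interval integral of the step function `1{u ≤ s}` is a difference of positive parts. -/
theorem intervalIntegral_ite_le (u a b : ℝ) :
    ∫ s in a..b, (if u ≤ s then (1 : ℝ) else 0) = max (b - u) 0 - max (a - u) 0 := by
  refine integral_eq_of_hasDerivAt_off_countable (fun s : ℝ => max (s - u) 0) _
    (Set.countable_singleton u) (by fun_prop) ?_ (intervalIntegrable_ite_le u a b)
  rintro x ⟨-, hx⟩
  rcases lt_or_gt_of_ne (show x ≠ u from hx) with h | h
  · rw [if_neg h.not_ge]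
    refine (hasDerivAt_const x (0 : ℝ)).congr_of_eventuallyEq ?_
    filter_upwards [eventually_lt_nhds h] with y hy
    exact max_eq_right (by linarith)
  · rw [if_pos h.le]
    refine ((hasDerivAt_id x).sub_const u).congr_of_eventuallyEq ?_
    filter_upwards [eventually_gt_nhds h] with y hy
    exact max_eq_left (by linarith)

/-- **Knight's identity** for the check function: for all `u, v ∈ ℝ`,
`ρ_τ(u − v) − ρ_τ(u) = −v (τ − 1{u ≤ 0}) + ∫_0^v (1{u ≤ s} − 1{u ≤ 0}) ds`. -/
theorem knight_identity (τ : ℝ) :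
    ∀ u v : ℝ,
      checkFun τ (u - v) - checkFun τ u =
        -v * (τ - (if u ≤ 0 then (1 : ℝ) else 0)) +
          ∫ s in (0 : ℝ)..v,
            ((if u ≤ s then (1 : ℝ) else 0) - (if u ≤ 0 then (1 : ℝ) else 0)) := by
  intro u v
  rw [intervalIntegral.integral_sub (intervalIntegrable_ite_le u 0 v) intervalIntegrable_const,
    intervalIntegral_ite_le, intervalIntegral.integral_const]
  simp only [checkFun, max_def, smul_eq_mul]
  split_ifs <;> linarith
end

section
/- For all u₁, u₂ ∈ ℝ and all c ∈ (0, 1]: ∫_0^{u₂} (1{u₁ ≤ z} − 1{u₁ ≤ 0}) dz ≥ ∫_0^{c·u₂} (1{u₁ ≤ z} − 1{u₁ ≤ 0}) dz ≥ 0. -/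
open MeasureTheory

/-- A monotone function vanishing at `0` has nonnegative oriented integral along any segment
pointing away from `0`. -/
theorem Monotone.intervalIntegral_nonneg_of_away_from_zero {f : ℝ → ℝ} (hf : Monotone f)
    (h0 : f 0 = 0) {a b : ℝ} (hab : (0 ≤ a ∧ a ≤ b) ∨ (b ≤ a ∧ a ≤ 0)) :
    0 ≤ ∫ z in a..b, f z := by
  rcases hab with ⟨ha, hab⟩ | ⟨hba, ha⟩
  · exact intervalIntegral.integral_nonneg hab fun z hz => h0 ▸ hf (ha.trans hz.1)
  · rw [intervalIntegral.integral_symm, ← intervalIntegral.integral_neg]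
    exact intervalIntegral.integral_nonneg hba fun z hz =>
      neg_nonneg.mpr (h0 ▸ hf (hz.2.trans ha))

/-- The recentered indicator `z ↦ 1{u ≤ z} - 1{u ≤ 0}` is monotone. -/
theorem monotone_recentered_indicator (u : ℝ) :
    Monotone fun z : ℝ => (if u ≤ z then (1 : ℝ) else 0) - (if u ≤ 0 then (1 : ℝ) else 0) := by
  intro x y hxy
  refine sub_le_sub_right ?_ _
  by_cases hx : u ≤ x
  · simp [hx, hx.trans hxy]
  · simp only [hx, if_false]
    split_ifs <;> norm_num

/-- Monotonicity and nonnegativity of the oriented integral of the recentered indicator: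
for all `u₁, u₂ ∈ ℝ` and `c ∈ (0, 1]`,
`∫_0^{u₂} (1{u₁ ≤ z} − 1{u₁ ≤ 0}) dz ≥ ∫_0^{c u₂} (1{u₁ ≤ z} − 1{u₁ ≤ 0}) dz ≥ 0`. -/
theorem indicator_integral_shrink (u₁ u₂ c : ℝ) (hc0 : 0 < c) (hc1 : c ≤ 1) :
    ((∫ z in (0 : ℝ)..(c * u₂),
        ((if u₁ ≤ z then (1 : ℝ) else 0) - (if u₁ ≤ 0 then (1 : ℝ) else 0))) ≤
      ∫ z in (0 : ℝ)..u₂,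
        ((if u₁ ≤ z then (1 : ℝ) else 0) - (if u₁ ≤ 0 then (1 : ℝ) else 0))) ∧
    (0 ≤ ∫ z in (0 : ℝ)..(c * u₂),
        ((if u₁ ≤ z then (1 : ℝ) else 0) - (if u₁ ≤ 0 then (1 : ℝ) else 0))) := by
  have hf := monotone_recentered_indicator u₁
  have h0 := sub_self (if u₁ ≤ 0 then (1 : ℝ) else 0)
  constructor
  · rw [← sub_nonneg, intervalIntegral.integral_interval_sub_left
      hf.intervalIntegrable hf.intervalIntegrable]
    refine hf.intervalIntegral_nonneg_of_away_from_zero h0 ?_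
    rcases le_total 0 u₂ with hu | hu
    · exact Or.inl ⟨mul_nonneg hc0.le hu, mul_le_of_le_one_left hu hc1⟩
    · exact Or.inr ⟨by nlinarith, mul_nonpos_of_nonneg_of_nonpos hc0.le hu⟩
  · refine hf.intervalIntegral_nonneg_of_away_from_zero h0 ?_
    rcases le_total 0 (c * u₂) with hu | hu
    · exact Or.inl ⟨le_rfl, hu⟩
    · exact Or.inr ⟨hu, le_rfl⟩
end

section
/- Let f̲ > 0 and f̄' ≥ 0. Let F : ℝ → ℝ be differentiable with derivative f, where f(0) ≥ f̲ and f is differentiable with |f'(s)| ≤ f̄' for every s ∈ ℝ. Then for every v ∈ ℝ: ∫_0^v (F(s) − F(0)) ds ≥ (f̲/2)·v² − (f̄'/6)·|v|³. If in addition 2·f̄'·|v| ≤ 3·f̲, then ∫_0^v (F(s) − F(0)) ds ≥ (f̲/4)·v². -/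
open MeasureTheory

/-- A function vanishing at `0` whose derivative is nonnegative on `[0, ∞)` is nonnegative there. -/
theorem nonneg_of_hasDerivAt_nonneg {g g' : ℝ → ℝ} (hg : ∀ s, HasDerivAt g (g' s) s)
    (h0 : g 0 = 0) (hg' : ∀ s, 0 ≤ s → 0 ≤ g' s) {x : ℝ} (hx : 0 ≤ x) : 0 ≤ g x := by
  have hmono : MonotoneOn g (Set.Ici 0) := by
    refine monotoneOn_of_deriv_nonneg (convex_Ici 0)
      (fun s _ => (hg s).continuousAt.continuousWithinAt)
      (fun s _ => (hg s).differentiableAt.differentiableWithinAt) fun s hs => ?_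
    rw [(hg s).deriv]
    exact hg' s (interior_subset hs)
  simpa [h0] using hmono Set.self_mem_Ici hx hx

/-- Quadratic-minus-cubic lower bound, to the right of `0`, on the integral of `F - F 0`. -/
theorem quadratic_sub_cubic_le_integral_of_nonneg {a b : ℝ} {F f f' : ℝ → ℝ}
    (hF : ∀ s, HasDerivAt F (f s) s) (hf0 : a ≤ f 0) (hf : ∀ s, HasDerivAt f (f' s) s)
    (hf' : ∀ s, |f' s| ≤ b) {v : ℝ} (hv : 0 ≤ v) :
    a / 2 * v ^ 2 - b / 6 * v ^ 3 ≤ ∫ s in (0 : ℝ)..v, (F s - F 0) := by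
  have hid (s : ℝ) : HasDerivAt (fun x : ℝ => x) 1 s := hasDerivAt_id' s
  have hcont : Continuous fun s => F s - F 0 :=
    (continuous_iff_continuousAt.2 fun s => (hF s).continuousAt).sub continuous_const
  have h₁ (x : ℝ) (hx : 0 ≤ x) : 0 ≤ f x - f 0 + b * x := by
    refine nonneg_of_hasDerivAt_nonneg (g := fun x => f x - f 0 + b * x)
      (fun s => ((hf s).sub_const (f 0)).add ((hid s).const_mul b)) (by simp) (fun s _ => ?_) hx
    linarith [neg_le_of_abs_le (hf' s)]
  have h₂ (x : ℝ) (hx : 0 ≤ x) : 0 ≤ F x - F 0 - a * x + b / 2 * x ^ 2 := by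
    refine nonneg_of_hasDerivAt_nonneg (g := fun x => F x - F 0 - a * x + b / 2 * x ^ 2)
      (fun s => (((hF s).sub_const (F 0)).sub ((hid s).const_mul a)).add
        (((hid s).pow 2).const_mul (b / 2))) (by simp) (fun s hs => ?_) hx
    norm_num
    linarith [h₁ s hs]
  have h₃ : 0 ≤ (∫ s in (0 : ℝ)..v, (F s - F 0)) - a / 2 * v ^ 2 + b / 6 * v ^ 3 := by
    refine nonneg_of_hasDerivAt_nonneg
      (g := fun x => (∫ s in (0 : ℝ)..x, (F s - F 0)) - a / 2 * x ^ 2 + b / 6 * x ^ 3)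
      (fun s => ((hcont.integral_hasStrictDerivAt 0 s).hasDerivAt.sub
        (((hid s).pow 2).const_mul (a / 2))).add
        (((hid s).pow 3).const_mul (b / 6))) (by simp) (fun s hs => ?_) hv
    norm_num
    linarith [h₂ s hs]
  linarith

/-- Local strong-convexity lower bound on the integrated recentered CDF: if `F` has
derivative `f` with `f 0 ≥ f̲ > 0` and `f` has derivative `f'` with `|f'| ≤ f̄'`, then
`∫_0^v (F(s) − F(0)) ds ≥ (f̲/2) v² − (f̄'/6) |v|³`, and if moreover
`2 f̄' |v| ≤ 3 f̲` then `∫_0^v (F(s) − F(0)) ds ≥ (f̲/4) v²`. -/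
theorem integrated_recentered_cdf_lower_bound
    (flow fpbd : ℝ) (hflow : 0 < flow) (hfpbd : 0 ≤ fpbd)
    (F f f' : ℝ → ℝ)
    (hF : ∀ s : ℝ, HasDerivAt F (f s) s)
    (hf0 : flow ≤ f 0)
    (hf : ∀ s : ℝ, HasDerivAt f (f' s) s)
    (hf' : ∀ s : ℝ, |f' s| ≤ fpbd) :
    ∀ v : ℝ,
      ((flow / 2) * v ^ 2 - (fpbd / 6) * |v| ^ 3 ≤ ∫ s in (0 : ℝ)..v, (F s - F 0)) ∧
      (2 * fpbd * |v| ≤ 3 * flow →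
        (flow / 4) * v ^ 2 ≤ ∫ s in (0 : ℝ)..v, (F s - F 0)) := by
  intro v
  have key : flow / 2 * v ^ 2 - fpbd / 6 * |v| ^ 3 ≤ ∫ s in (0 : ℝ)..v, (F s - F 0) := by
    rcases le_total 0 v with hv | hv
    · rw [abs_of_nonneg hv]
      exact quadratic_sub_cubic_le_integral_of_nonneg hF hf0 hf hf' hv
    · have hG (s : ℝ) : HasDerivAt (fun x => -F (-x)) (f (-s)) s :=
        ((hF (-s)).comp s (hasDerivAt_neg s)).neg.congr_deriv (by ring)
      have hg (s : ℝ) : HasDerivAt (fun x => f (-x)) (-f' (-s)) s :=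
        ((hf (-s)).comp s (hasDerivAt_neg s)).congr_deriv (by ring)
      have h := quadratic_sub_cubic_le_integral_of_nonneg (a := flow) hG (by simpa using hf0) hg
        (fun s => by simpa using hf' (-s)) (neg_nonneg.2 hv)
      have hint : ∫ s in (0 : ℝ)..-v, (-F (-s) - -F (-0)) = ∫ s in (0 : ℝ)..v, (F s - F 0) := by
        rw [intervalIntegral.integral_comp_neg (fun s => -F s - -F (-0)),
          intervalIntegral.integral_symm, ← intervalIntegral.integral_neg]
        simp only [neg_neg, neg_zero]
        congr 1
        ext s
        ring
      rw [hint, neg_sq] at h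
      rwa [abs_of_nonpos hv]
  refine ⟨key, fun hsmall => ?_⟩
  have hcube : |v| ^ 3 = |v| * v ^ 2 := by rw [← sq_abs v]; ring
  rw [hcube] at key
  linarith [mul_le_mul_of_nonneg_right hsmall (sq_nonneg v)]
end

section
/- Let T, K ≥ 1, φ_1, …, φ_T ∈ ℝ^K, f̲ > 0, f̄' ≥ 0, and let F_1, …, F_T : ℝ → ℝ be nondecreasing and differentiable with derivatives f_t satisfying f_t(0) ≥ f̲, each f_t differentiable with |f_t'(s)| ≤ f̄' for all s ∈ ℝ. Let c ∈ (0, 1] satisfy c·f̄' < 3·f̲, and suppose q > 0 is such that for every Δ ∈ ℝ^K, (1/T) Σ_{t=1}^T |⟨φ_t, Δ⟩|³ ≤ q^{−1} · ((1/T) Σ_{t=1}^T ⟨φ_t, Δ⟩²)^{3/2}. Define G(Δ) = (1/T) Σ_{t=1}^T ∫_0^{⟨φ_t, Δ⟩} (F_t(s) − F_t(0)) ds and Q(Δ) = ((1/T) Σ_{t=1}^T ⟨φ_t, Δ⟩²)^{1/2}. Then for every Δ ∈ ℝ^K: G(Δ) ≥ ((3c²f̲ − c³f̄')/6) · min( Q(Δ)²,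 q·Q(Δ) ). -/
open MeasureTheory

/-- The population-type objective increment
`G(Δ) = (1/T) Σ_t ∫_0^{⟨φ_t, Δ⟩} (F_t(s) − F_t(0)) ds`. -/
noncomputable def objIncrement (T K : ℕ) (φ : Fin T → Fin K → ℝ)
    (F : Fin T → ℝ → ℝ) (Δ : Fin K → ℝ) : ℝ :=
  (1 / (T : ℝ)) * ∑ t : Fin T, ∫ s in (0 : ℝ)..(∑ k : Fin K, φ t k * Δ k), (F t s - F t 0)

/-- The self-normalized quadratic scale `Q(Δ) = ((1/T) Σ_t ⟨φ_t, Δ⟩²)^{1/2}`. -/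
noncomputable def quadScale (T K : ℕ) (φ : Fin T → Fin K → ℝ) (Δ : Fin K → ℝ) : ℝ :=
  Real.sqrt ((1 / (T : ℝ)) * ∑ t : Fin T, (∑ k : Fin K, φ t k * Δ k) ^ 2)

/-- The recentered integral of a monotone function is nonnegative. -/
lemma integral_recentered_nonneg {F : ℝ → ℝ} (hF : Monotone F) {v : ℝ} (hv : 0 ≤ v) :
    0 ≤ ∫ s in (0 : ℝ)..v, (F s - F 0) :=
  intervalIntegral.integral_nonneg hv fun _ hs => sub_nonneg.2 (hF hs.1)

/-- The recentered integral of a monotone function is star-shaped. -/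
lemma integral_recentered_mul_le {F : ℝ → ℝ} (hF : Monotone F) {a v : ℝ}
    (ha0 : 0 ≤ a) (ha1 : a ≤ 1) (hv : 0 ≤ v) :
    ∫ s in (0 : ℝ)..a * v, (F s - F 0) ≤ a * ∫ s in (0 : ℝ)..v, (F s - F 0) := by
  have hcomp := intervalIntegral.mul_integral_comp_mul_left
    (f := fun s => F s - F 0) (a := 0) (b := v) a
  rw [mul_zero] at hcomp
  rw [← hcomp]
  have hmono : Monotone fun s => F (a * s) := fun x y hxy =>
    hF (mul_le_mul_of_nonneg_left hxy ha0)
  refine mul_le_mul_of_nonneg_left (intervalIntegral.integral_mono_on hv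
    (hmono.intervalIntegrable.sub intervalIntegrable_const)
    (hF.intervalIntegrable.sub intervalIntegrable_const) fun s hs => ?_) ha0
  exact sub_le_sub_right (hF (mul_le_of_le_one_left hs.1 ha1)) _

/-- Second-order Taylor lower bound for the recentered integral on the positive half-line. -/
lemma taylor_le_integral_recentered {F f f' : ℝ → ℝ} {m M v : ℝ}
    (hF : ∀ s, HasDerivAt F (f s) s) (hf : ∀ s, HasDerivAt f (f' s) s)
    (hm : m ≤ f 0) (hM : ∀ s, |f' s| ≤ M) (hv : 0 ≤ v) :
    m * v ^ 2 / 2 - M * v ^ 3 / 6 ≤ ∫ s in (0 : ℝ)..v, (F s - F 0) := by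
  have hcont : Continuous F := continuous_iff_continuousAt.2 fun s => (hF s).continuousAt
  have hint (s : ℝ) : HasDerivAt (fun v => ∫ u in (0 : ℝ)..v, (F u - F 0)) (F s - F 0) s :=
    (hcont.sub continuous_const).integral_hasStrictDerivAt 0 s |>.hasDerivAt
  have hmono {g g' : ℝ → ℝ} (hg : ∀ s, HasDerivAt g (g' s) s)
      (hg' : ∀ s, 0 ≤ s → 0 ≤ g' s) {s : ℝ} (hs : 0 ≤ s) : g 0 ≤ g s :=
    monotoneOn_of_hasDerivWithinAt_nonneg (convex_Ici 0)
      (fun x _ => (hg x).continuousAt.continuousWithinAt)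
      (fun x _ => (hg x).hasDerivWithinAt)
      (fun x hx => hg' x (interior_subset hx)) Set.self_mem_Ici hs hs
  have h₁ (s : ℝ) (hs : 0 ≤ s) : 0 ≤ f s - m + M * s := by
    have := hmono (g := fun s => f s - m + M * s) (g' := fun s => f' s + M * 1)
      (fun s => ((hf s).sub_const m).add ((hasDerivAt_id s).const_mul M))
      (fun s _ => by linarith [neg_abs_le (f' s), hM s]) hs
    linarith
  have h₂ (s : ℝ) (hs : 0 ≤ s) : 0 ≤ F s - F 0 - m * s + M * s ^ 2 / 2 := by
    have := hmono (g := fun s => F s - F 0 - m * s + M * s ^ 2 / 2)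
      (g' := fun s => f s - m + M * s)
      (fun s => by
        refine ((((hF s).sub_const (F 0)).sub ((hasDerivAt_id s).const_mul m)).add
          (((hasDerivAt_pow 2 s).const_mul M).div_const 2)).congr_deriv ?_
        push_cast; ring) h₁ hs
    linarith
  have := hmono
    (g := fun s => (∫ u in (0 : ℝ)..s, (F u - F 0)) - m * s ^ 2 / 2 + M * s ^ 3 / 6)
    (g' := fun s => F s - F 0 - m * s + M * s ^ 2 / 2)
    (fun s => by
      refine (((hint s).sub (((hasDerivAt_pow 2 s).const_mul m).div_const 2)).add
        (((hasDerivAt_pow 3 s).const_mul M).div_const 6)).congr_deriv ?_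
      push_cast; ring) h₂ hv
  simp only [intervalIntegral.integral_same] at this
  linarith

/-- Rescaled Taylor lower bound for the recentered integral. -/
lemma scaled_taylor_le_mul_integral_recentered {F f f' : ℝ → ℝ} {m M c a : ℝ}
    (hmono : Monotone F)
    (hF : ∀ s, HasDerivAt F (f s) s) (hf : ∀ s, HasDerivAt f (f' s) s)
    (hm : m ≤ f 0) (hM : ∀ s, |f' s| ≤ M)
    (hc0 : 0 ≤ c) (hc1 : c ≤ 1) (ha0 : 0 ≤ a) (ha1 : a ≤ 1) (v : ℝ) :
    m * (c * a) ^ 2 / 2 * v ^ 2 - M * (c * a) ^ 3 / 6 * |v| ^ 3 ≤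
      a * ∫ s in (0 : ℝ)..v, (F s - F 0) := by
  wlog hv : 0 ≤ v generalizing F f f' v
  · have hrefl := this (F := fun s => -F (-s)) (f := fun s => f (-s)) (f' := fun s => -f' (-s))
      (fun x y hxy => neg_le_neg (hmono (neg_le_neg hxy)))
      (fun s => ((hF (-s)).comp s (hasDerivAt_neg s)).neg.congr_deriv (by ring))
      (fun s => ((hf (-s)).comp s (hasDerivAt_neg s)).congr_deriv (by ring))
      (by simpa using hm) (fun s => by simpa using hM (-s)) (-v) (by linarith)
    have hint : ∫ s in (0 : ℝ)..-v, (-F (-s) - -F (-0)) = ∫ s in (0 : ℝ)..v, (F s - F 0) := by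
      have h := intervalIntegral.integral_comp_neg (a := 0) (b := -v)
        (fun s => -F s - -F 0)
      rw [neg_neg, neg_zero] at h
      rw [neg_zero, h, intervalIntegral.integral_symm, ← intervalIntegral.integral_neg]
      congr 1
      ext s
      ring
    rw [hint] at hrefl
    simpa using hrefl
  have hav : 0 ≤ a * v := mul_nonneg ha0 hv
  have h₁ := taylor_le_integral_recentered hF hf hm hM (mul_nonneg hc0 hav)
  have h₂ := integral_recentered_mul_le hmono hc0 hc1 hav
  have h₃ := integral_recentered_mul_le hmono ha0 ha1 hv
  have h₄ := mul_le_of_le_one_left (integral_recentered_nonneg hmono hav) hc1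
  rw [abs_of_nonneg hv]
  linarith

/-- Deterministic lower bound on the integrated recentered-CDF objective:
under the density bounds `f_t(0) ≥ f̲ > 0`, `|f_t'| ≤ f̄'`, a constant `c ∈ (0,1]` with
`c f̄' < 3 f̲`, and the self-normalization condition with constant `q > 0`, one has
`G(Δ) ≥ ((3c²f̲ − c³f̄')/6) · min(Q(Δ)², q·Q(Δ))` for every `Δ ∈ ℝ^K`. -/
theorem objIncrement_strong_lower_bound (T K : ℕ) (hT : 1 ≤ T) (hK : 1 ≤ K)
    (φ : Fin T → Fin K → ℝ)
    (flow fpbd : ℝ) (hflow : 0 < flow) (hfpbd : 0 ≤ fpbd)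
    (F f f' : Fin T → ℝ → ℝ)
    (hFmono : ∀ t, Monotone (F t))
    (hFderiv : ∀ (t : Fin T) (s : ℝ), HasDerivAt (F t) (f t s) s)
    (hf0 : ∀ t : Fin T, flow ≤ f t 0)
    (hfderiv : ∀ (t : Fin T) (s : ℝ), HasDerivAt (f t) (f' t s) s)
    (hf'bd : ∀ (t : Fin T) (s : ℝ), |f' t s| ≤ fpbd)
    (c : ℝ) (hc0 : 0 < c) (hc1 : c ≤ 1) (hcf : c * fpbd < 3 * flow)
    (q : ℝ) (hq : 0 < q)
    (hqcond : ∀ Δ : Fin K → ℝ,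
      (1 / (T : ℝ)) * ∑ t : Fin T, |∑ k : Fin K, φ t k * Δ k| ^ 3 ≤
        q⁻¹ * ((1 / (T : ℝ)) * ∑ t : Fin T, (∑ k : Fin K, φ t k * Δ k) ^ 2) ^ ((3 : ℝ) / 2)) :
    ∀ Δ : Fin K → ℝ,
      ((3 * c ^ 2 * flow - c ^ 3 * fpbd) / 6) *
          min (quadScale T K φ Δ ^ 2) (q * quadScale T K φ Δ) ≤
        objIncrement T K φ F Δ := by
  intro Δ
  set Q := quadScale T K φ Δ
  have hQ0 : 0 ≤ Q := Real.sqrt_nonneg _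
  have hA0 : 0 ≤ (1 / (T : ℝ)) * ∑ t : Fin T, (∑ k : Fin K, φ t k * Δ k) ^ 2 := by positivity
  have hA : (1 / (T : ℝ)) * ∑ t : Fin T, (∑ k : Fin K, φ t k * Δ k) ^ 2 = Q ^ 2 :=
    (Real.sq_sqrt hA0).symm
  have hB := hqcond Δ
  have hpow : (Q ^ 2) ^ ((3 : ℝ) / 2) = Q ^ 3 := by
    rw [← Real.rpow_natCast_mul hQ0, ← Real.rpow_natCast]
    norm_num
  rw [hA, hpow] at hB
  have hscaled {a : ℝ} (ha0 : 0 < a) (ha1 : a ≤ 1) (haq : a * Q ≤ q) :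
      ((3 * c ^ 2 * flow - c ^ 3 * fpbd) / 6) * (a * Q ^ 2) ≤ objIncrement T K φ F Δ := by
    have hsum := mul_le_mul_of_nonneg_left (Finset.sum_le_sum fun t (_ : t ∈ Finset.univ) =>
      scaled_taylor_le_mul_integral_recentered (hFmono t) (hFderiv t) (hfderiv t) (hf0 t)
        (hf'bd t) hc0.le hc1 ha0.le ha1 (∑ k : Fin K, φ t k * Δ k))
      (by positivity : (0 : ℝ) ≤ 1 / T)
    rw [Finset.sum_sub_distrib, ← Finset.mul_sum, ← Finset.mul_sum, ← Finset.mul_sum,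
      mul_sub, mul_left_comm, hA, mul_left_comm, mul_left_comm (1 / (T : ℝ)) a] at hsum
    change _ ≤ a * objIncrement T K φ F Δ at hsum
    have hcube : a * (q⁻¹ * Q ^ 3) ≤ Q ^ 2 := by
      calc a * (q⁻¹ * Q ^ 3) = q⁻¹ * (a * Q) * Q ^ 2 := by ring
        _ ≤ q⁻¹ * q * Q ^ 2 := by gcongr
        _ = Q ^ 2 := by rw [inv_mul_cancel₀ hq.ne', one_mul]
    have hthird := (mul_le_mul_of_nonneg_left hB ha0.le).trans hcube
    have hcoeff : 0 ≤ fpbd * c ^ 3 * a ^ 2 / 6 := by positivity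
    have := mul_le_mul_of_nonneg_left hthird hcoeff
    refine le_of_mul_le_mul_left ?_ ha0
    linarith
  have hC : 0 ≤ (3 * c ^ 2 * flow - c ^ 3 * fpbd) / 6 := by
    have := mul_nonneg (sq_nonneg c) (sub_nonneg.2 hcf.le)
    linarith
  rcases le_or_gt Q q with hle | hlt
  · refine (mul_le_mul_of_nonneg_left (min_le_left _ _) hC).trans ?_
    simpa using hscaled one_pos le_rfl (by simpa using hle)
  · have hQpos : 0 < Q := hq.trans hlt
    refine (mul_le_mul_of_nonneg_left (min_le_right _ _) hC).trans ?_
    have h := hscaled (div_pos hq hQpos) ((div_le_one hQpos).2 hlt.le)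
      (div_mul_cancel₀ q hQpos.ne').le
    rwa [pow_two Q, ← mul_assoc (q / Q), div_mul_cancel₀ q hQpos.ne'] at h
end

section
/- Let T, K ≥ 1 and φ_1, …, φ_T ∈ ℝ^K. Suppose c > 0 satisfies (1/T) Σ_{t=1}^T ⟨φ_t, Δ⟩² ≥ c·‖Δ‖₂² for every Δ ∈ ℝ^K, and B > 0 satisfies (1/T) Σ_{t=1}^T ‖φ_t‖₂³ ≤ B. Then for every Δ ∈ ℝ^K: ((1/T) Σ_{t=1}^T ⟨φ_t, Δ⟩²)^{3/2} ≥ (c^{3/2}/B) · (1/T) Σ_{t=1}^T |⟨φ_t, Δ⟩|³. -/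
/-- Cauchy–Schwarz for finite sums, with absolute value and square roots. -/
theorem abs_sum_mul_le_sqrt_mul_sqrt {ι : Type*} (s : Finset ι) (f g : ι → ℝ) :
    |∑ i ∈ s, f i * g i| ≤ Real.sqrt (∑ i ∈ s, f i ^ 2) * Real.sqrt (∑ i ∈ s, g i ^ 2) := by
  rw [← Real.sqrt_mul (Finset.sum_nonneg fun i _ => sq_nonneg (f i))]
  exact Real.abs_le_sqrt (Finset.sum_mul_sq_le_sq_mul_sq s f g)

theorem sqrt_pow_three_eq_rpow {x : ℝ} (hx : 0 ≤ x) :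
    Real.sqrt x ^ 3 = x ^ ((3 : ℝ) / 2) := by
  rw [Real.sqrt_eq_rpow, ← Real.rpow_natCast, ← Real.rpow_mul hx]
  norm_num

/-- Deterministic lower bound for the self-normalization ratio: if the design
satisfies `(1/T) Σ_t ⟨φ_t, Δ⟩² ≥ c ‖Δ‖₂²` for all `Δ` and the average cubed norm is
bounded, `(1/T) Σ_t ‖φ_t‖₂³ ≤ B`, then for every `Δ ∈ ℝ^K`:
`((1/T) Σ_t ⟨φ_t, Δ⟩²)^{3/2} ≥ (c^{3/2}/B) · (1/T) Σ_t |⟨φ_t, Δ⟩|³`. -/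
theorem self_normalization_lower_bound
    (T K : ℕ) (hT : 1 ≤ T) (hK : 1 ≤ K)
    (φ : Fin T → Fin K → ℝ) (c B : ℝ) (hc : 0 < c) (hB : 0 < B)
    (hlow : ∀ Δ : Fin K → ℝ,
      c * ∑ k : Fin K, (Δ k) ^ 2 ≤ (1 / (T : ℝ)) * ∑ t : Fin T, (∑ k : Fin K, φ t k * Δ k) ^ 2)
    (hcube : (1 / (T : ℝ)) * ∑ t : Fin T, (Real.sqrt (∑ k : Fin K, (φ t k) ^ 2)) ^ 3 ≤ B) :
    ∀ Δ : Fin K → ℝ,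
      (c ^ ((3 : ℝ) / 2) / B) * ((1 / (T : ℝ)) * ∑ t : Fin T, |∑ k : Fin K, φ t k * Δ k| ^ 3) ≤
        ((1 / (T : ℝ)) * ∑ t : Fin T, (∑ k : Fin K, φ t k * Δ k) ^ 2) ^ ((3 : ℝ) / 2) := by
  intro Δ
  have hS : 0 ≤ ∑ k : Fin K, Δ k ^ 2 := Finset.sum_nonneg fun k _ => sq_nonneg (Δ k)
  have havg : (1 / (T : ℝ)) * ∑ t : Fin T, |∑ k : Fin K, φ t k * Δ k| ^ 3 ≤
      B * (∑ k : Fin K, Δ k ^ 2) ^ ((3 : ℝ) / 2) := by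
    rw [← sqrt_pow_three_eq_rpow hS]
    refine le_trans ?_ (mul_le_mul_of_nonneg_right hcube (by positivity))
    rw [mul_assoc, Finset.sum_mul]
    gcongr with t
    rw [← mul_pow]
    gcongr
    exact abs_sum_mul_le_sqrt_mul_sqrt _ _ _
  calc
    _ ≤ c ^ ((3 : ℝ) / 2) / B * (B * (∑ k : Fin K, Δ k ^ 2) ^ ((3 : ℝ) / 2)) := by gcongr
    _ = (c * ∑ k : Fin K, Δ k ^ 2) ^ ((3 : ℝ) / 2) := by
      rw [Real.mul_rpow hc.le hS]
      field_simp
    _ ≤ _ := Real.rpow_le_rpow (by positivity) (hlow Δ) (by norm_num)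
end
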